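/- Consider a deterministic-transition episodic contextual MDP M whose Bellman residuals are linearly embeddable: for every f ∈ F, h ∈ [H] and every state-action pair, f^h(x^h,a^h) − [𝒯f]^h(x^h,a^h) = w^h(f, x^1(x^h))ᵀ φ^h(x^h,a^h) with φ^h(x^h,a^h) ∈ ℝ^K. Then the MDP decoupling coefficient satisfies dc(F, M) ≤ K; that is, for every probability distribution q over F, every initial context x^1, every step h and every μ > 0: E_{f∼q} E_{(x^h,a^h)∼p(·|f,x^1)} [ f^h(x^h,a^h) − [𝒯f]^h(x^h,a^h) ] ≤ μ E_{(x^h,a^h)∼π_q(·|x^1)} E_{f̃∼q} ( f̃^h(x^h,a^h) − [𝒯f̃]^h(x^h,a^h) )² + K/(4μ), where π_q(·|x^1) = E_{f∼q} p(·|f,x^1). -/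

import Mathlib

open MeasureTheory

open Matrix in
/-- A real symmetric matrix is diagonalized by an orthogonal change of coordinates. -/
theorem Matrix.IsSymm.exists_orthogonal_diagonalization {ι : Type*} [Fintype ι] [DecidableEq ι]
    {A : Matrix ι ι ℝ} (hA : A.IsSymm) :
    ∃ (U : Matrix ι ι ℝ) (d : ι → ℝ), U * Uᵀ = 1 ∧ Uᵀ * A * U = diagonal d := by
  have hA' : A.IsHermitian := by
    rwa [Matrix.IsHermitian, conjTranspose_eq_transpose_of_trivial]
  have hU := Unitary.mul_star_self_of_mem hA'.eigenvectorUnitary.2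
  have hd := hA'.conjStarAlgAut_star_eigenvectorUnitary
  rw [Unitary.conjStarAlgAut_star_apply] at hd
  rw [star_eq_conjTranspose, conjTranspose_eq_transpose_of_trivial] at hU hd
  exact ⟨hA'.eigenvectorUnitary, hA'.eigenvalues, hU, hd⟩

/-- Mean of a product bounded by one quarter plus the product of second moments. -/
theorem integral_mul_le_quarter_add {Ω : Type*} [MeasurableSpace Ω] {q : Measure Ω}
    {X Y : Ω → ℝ} (hX : MemLp X 2 q) (hY : MemLp Y 2 q) {μ : ℝ} (hμ : 0 < μ) :
    ∫ ω, X ω * Y ω ∂q ≤ 1 / (4 * μ) + μ * ((∫ ω, X ω ^ 2 ∂q) * ∫ ω, Y ω ^ 2 ∂q) := by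
  have hX2 := hX.integrable_sq
  have hY2 := hY.integrable_sq
  have hXY : Integrable (fun ω => X ω * Y ω) q := hX.integrable_mul hY
  have hnX : 0 ≤ ∫ ω, X ω ^ 2 ∂q := integral_nonneg fun ω => sq_nonneg _
  rcases hnX.eq_or_lt with h0 | hpos
  · have hae := (integral_eq_zero_iff_of_nonneg (fun ω => sq_nonneg (X ω)) hX2).1 h0.symm
    have hz : ∫ ω, X ω * Y ω ∂q = 0 := by
      apply integral_eq_zero_of_ae
      filter_upwards [hae] with ω hω
      have : X ω = 0 := by simpa using hω
      simp [this]
    rw [hz, ← h0]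
    simp only [zero_mul, mul_zero, add_zero]
    positivity
  · set s := ∫ ω, X ω ^ 2 ∂q with hs
    calc ∫ ω, X ω * Y ω ∂q
        ≤ ∫ ω, (1 / (4 * μ * s) * X ω ^ 2 + μ * s * Y ω ^ 2) ∂q := by
          refine integral_mono hXY ((hX2.const_mul _).add (hY2.const_mul _)) fun ω => ?_
          have key : 1 / (4 * μ * s) * X ω ^ 2 + μ * s * Y ω ^ 2 - X ω * Y ω
              = 1 / (4 * μ * s) * (X ω - 2 * μ * s * Y ω) ^ 2 := by
            field_simp
            ring
          have : 0 ≤ 1 / (4 * μ * s) * (X ω - 2 * μ * s * Y ω) ^ 2 := by positivity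
          dsimp only
          linarith
      _ = 1 / (4 * μ) + μ * (s * ∫ ω, Y ω ^ 2 ∂q) := by
          rw [integral_add (hX2.const_mul _) (hY2.const_mul _), integral_const_mul,
            integral_const_mul, ← hs]
          field_simp

/-- The second moment of a linear form in `W` is the quadratic form of the moment matrix. -/
theorem integral_sum_mul_mul_sum_mul {Ω ι : Type*} [MeasurableSpace Ω] [Fintype ι]
    {q : Measure Ω} {W : Ω → ι → ℝ} (hW : ∀ i, MemLp (fun ω => W ω i) 2 q) (a b : ι → ℝ) :
    ∫ ω, (∑ i, a i * W ω i) * (∑ j, b j * W ω j) ∂q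
      = ∑ i, ∑ j, a i * (∫ ω, W ω i * W ω j ∂q) * b j := by
  have hint : ∀ i j, Integrable (fun ω => W ω i * W ω j) q :=
    fun i j => (hW i).integrable_mul (hW j)
  have hint' : ∀ i j, Integrable (fun ω => a i * W ω i * (b j * W ω j)) q := fun i j =>
    ((hint i j).const_mul (a i * b j)).congr (.of_forall fun ω => by ring)
  simp_rw [Finset.sum_mul_sum]
  rw [integral_finsetSum _ fun i _ => integrable_finsetSum _ fun j _ => hint' i j]
  refine Finset.sum_congr rfl fun i _ => ?_
  rw [integral_finsetSum _ fun j _ => hint' i j]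
  refine Finset.sum_congr rfl fun j _ => ?_
  rw [mul_right_comm, ← integral_const_mul]
  congr 1 with ω
  ring

/-- Decoupling inequality when the coordinates of `W` are uncorrelated. -/
theorem integral_sum_mul_le_of_uncorrelated {Ω ι : Type*} [MeasurableSpace Ω] [Fintype ι]
    {q : Measure Ω} {W P : Ω → ι → ℝ}
    (hW : ∀ i, MemLp (fun ω => W ω i) 2 q) (hP : ∀ i, MemLp (fun ω => P ω i) 2 q)
    (horth : ∀ i j, i ≠ j → ∫ ω, W ω i * W ω j ∂q = 0) {μ : ℝ} (hμ : 0 < μ) :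
    ∫ ω, ∑ i, W ω i * P ω i ∂q ≤
      Fintype.card ι / (4 * μ) + μ * ∫ ω', ∫ ω, (∑ i, W ω i * P ω' i) ^ 2 ∂q ∂q := by
  classical
  have hquad : ∀ ω', ∫ ω, (∑ i, W ω i * P ω' i) ^ 2 ∂q
      = ∑ i, (∫ ω, W ω i ^ 2 ∂q) * P ω' i ^ 2 := by
    intro ω'
    simp_rw [sq (∑ i, _), mul_comm (W _ _)]
    rw [integral_sum_mul_mul_sum_mul hW]
    refine Finset.sum_congr rfl fun i _ => ?_
    rw [Finset.sum_eq_single i (fun j _ hj => by simp [horth i j hj.symm]) (by simp)]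
    simp_rw [← sq]
    ring
  have hWP : ∀ i, Integrable (fun ω => W ω i * P ω i) q := fun i => (hW i).integrable_mul (hP i)
  simp_rw [hquad]
  rw [integral_finsetSum _ fun i _ => hWP i,
    integral_finsetSum _ fun i _ => (hP i).integrable_sq.const_mul _]
  simp_rw [integral_const_mul]
  calc ∑ i, ∫ ω, W ω i * P ω i ∂q
      ≤ ∑ i, (1 / (4 * μ) + μ * ((∫ ω, W ω i ^ 2 ∂q) * ∫ ω, P ω i ^ 2 ∂q)) :=
        Finset.sum_le_sum fun i _ => integral_mul_le_quarter_add (hW i) (hP i) hμ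
    _ = _ := by
        rw [Finset.sum_add_distrib, ← Finset.mul_sum]
        simp [div_eq_mul_inv]

open Matrix in
/-- Decoupling inequality for a bilinear pairing of square-integrable random vectors. -/
theorem integral_sum_mul_le_decoupled {Ω ι : Type*} [MeasurableSpace Ω] [Fintype ι]
    {q : Measure Ω} {W P : Ω → ι → ℝ}
    (hW : ∀ i, MemLp (fun ω => W ω i) 2 q) (hP : ∀ i, MemLp (fun ω => P ω i) 2 q)
    {μ : ℝ} (hμ : 0 < μ) :
    ∫ ω, ∑ i, W ω i * P ω i ∂q ≤
      Fintype.card ι / (4 * μ) + μ * ∫ ω', ∫ ω, (∑ i, W ω i * P ω' i) ^ 2 ∂q ∂q := by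
  classical
  let A : Matrix ι ι ℝ := of fun i j => ∫ ω, W ω i * W ω j ∂q
  have hA : A.IsSymm := by
    ext i j
    simp only [A, transpose_apply, of_apply, mul_comm]
  obtain ⟨U, d, hU, hd⟩ := hA.exists_orthogonal_diagonalization
  have hrot : ∀ v u : ι → ℝ, ∑ i, (∑ k, U k i * v k) * (∑ k, U k i * u k) = ∑ i, v i * u i := by
    intro v u
    change (Uᵀ *ᵥ v) ⬝ᵥ (Uᵀ *ᵥ u) = v ⬝ᵥ u
    rw [dotProduct_mulVec, vecMul_transpose, mulVec_mulVec, hU, one_mulVec]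
  have hmem : ∀ {V : Ω → ι → ℝ}, (∀ i, MemLp (fun ω => V ω i) 2 q) →
      ∀ i, MemLp (fun ω => ∑ k, U k i * V ω k) 2 q := fun hV i =>
    memLp_finsetSum _ fun k _ => (hV k).const_mul _
  have := integral_sum_mul_le_of_uncorrelated (hmem hW) (hmem hP) (fun i j hij => ?_) hμ
  · simpa only [hrot] using this
  · rw [integral_sum_mul_mul_sum_mul hW]
    have h := congrFun (congrFun hd i) j
    rw [diagonal_apply_ne _ hij, mul_apply] at h
    simp_rw [mul_apply, Finset.sum_mul] at h
    rw [Finset.sum_comm]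
    exact h

/-- MDP decoupling coefficient bound for linearly embeddable Bellman residuals
(Lemma 5), at a fixed initial context `x¹` and step `h`.  For `f` in the function
class `F`, `fh f` is the step-`h` value function, `Tf f` its Bellman backup
`[𝒯f]^h`, and the residual factorizes as
`fh f x a − Tf f x a = ⟨w f, φ x a⟩` with `φ x a ∈ ℝ^K` (the weight `w f` depends
only on `f` since the context `x¹(x^h) = x¹` is fixed).  Since transitions are
deterministic, the step-`h` state-action pair of the greedy trajectory of `f` from
`x¹` is a deterministic pair `(Xh f, Ah f)`.  Then for every distribution `q` over
`F` and every `μ > 0`: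
`E_{f∼q}[fh f (Xh f) (Ah f) − Tf f (Xh f) (Ah f)]
  ≤ K/(4μ) + μ E_{f'∼q} E_{f∼q}(fh f (Xh f') (Ah f') − Tf f (Xh f') (Ah f'))²`,
i.e. `dc(F,M) ≤ K`. -/
theorem stmt_14 {F S Act : Type*} [MeasurableSpace F]
    (q : Measure F) [IsProbabilityMeasure q]
    (K : ℕ) (fh Tf : F → S → Act → ℝ)
    (w : F → Fin K → ℝ) (φ : S → Act → Fin K → ℝ)
    (hembed : ∀ f x a, fh f x a - Tf f x a = ∑ k, w f k * φ x a k)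
    (Xh : F → S) (Ah : F → Act)
    (hwm : ∀ k, Measurable fun f => w f k)
    (hw2 : ∀ k, Integrable (fun f => (w f k) ^ 2) q)
    (hφm : ∀ k, Measurable fun f => φ (Xh f) (Ah f) k)
    (C : ℝ) (hφb : ∀ f k, |φ (Xh f) (Ah f) k| ≤ C)
    (μ : ℝ) (hμ : 0 < μ) :
    ∫ f, (fh f (Xh f) (Ah f) - Tf f (Xh f) (Ah f)) ∂q ≤
      (K : ℝ) / (4 * μ) +
        μ * ∫ f', ∫ f, (fh f (Xh f') (Ah f') - Tf f (Xh f') (Ah f')) ^ 2 ∂q ∂q := by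
  have hP : ∀ k, MemLp (fun f => φ (Xh f) (Ah f) k) 2 q := fun k =>
    MemLp.of_bound (hφm k).aestronglyMeasurable C (.of_forall fun f => hφb f k)
  have hW : ∀ k, MemLp (fun f => w f k) 2 q := fun k =>
    (memLp_two_iff_integrable_sq (hwm k).aestronglyMeasurable).2 (hw2 k)
  simp_rw [hembed]
  simpa using integral_sum_mul_le_decoupled hW hP hμ
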